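/- Let V be a finite-dimensional real vector space with symmetric positive definite bilinear forms a and b, W ⊆ V a subspace, and P the a-orthogonal projection onto W. Define η = sup over f ∈ V with ‖f‖_b = 1 of inf over w ∈ W of ‖T f − w‖_a, where T: V → V is defined by a(T f, v) = b(f, v) for all v ∈ V. Then for every u ∈ V, ‖u − P u‖_b ≤ η ‖u − P u‖_a. -/

import Mathlib

theorem exists_apply_self_le_mul_norm_sq {E : Type*} [NormedAddCommGroup E] [NormedSpace ℝ E]
    [FiniteDimensional ℝ E] (b : E →ₗ[ℝ] E →ₗ[ℝ] ℝ) : ∃ C, ∀ x, b x x ≤ C * ‖x‖ ^ 2 := by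
  refine ⟨‖b.toContinuousBilinearMap‖, fun x => ?_⟩
  rw [sq, ← mul_assoc]
  exact (le_abs_self _).trans (b.toContinuousBilinearMap.le_opNorm₂ x x)

/-- On a finite-dimensional space every bilinear form is bounded on the diagonal by a multiple of
a positive definite symmetric one. -/
theorem exists_apply_self_le_mul_apply_self {V : Type*} [AddCommGroup V] [Module ℝ V]
    [FiniteDimensional ℝ V] (a b : V →ₗ[ℝ] V →ₗ[ℝ] ℝ)
    (hsa : ∀ x y, a x y = a y x) (hpa : ∀ x, x ≠ 0 → 0 < a x x) :
    ∃ C, ∀ x, b x x ≤ C * a x x := by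
  let core : InnerProductSpace.Core ℝ V :=
    { inner := fun x y => a x y
      conj_inner_symm := fun x y => by simpa using hsa y x
      re_inner_nonneg := fun x => by
        rcases eq_or_ne x 0 with rfl | hx
        · simp
        · simpa using (hpa x hx).le
      add_left := fun x y z => by simp
      smul_left := fun x y r => by simp
      definite := fun x hx => by
        by_contra h
        exact (hpa x h).ne' hx }
  let : NormedAddCommGroup V := core.toNormedAddCommGroup
  let : InnerProductSpace ℝ V := InnerProductSpace.ofCore core.toCore
  obtain ⟨C, hC⟩ := exists_apply_self_le_mul_norm_sq b
  exact ⟨C, fun x => (hC x).trans_eq (congrArg (C * ·) (real_inner_self_eq_norm_sq x).symm)⟩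

/-- The Cauchy-Schwarz inequality for a positive definite symmetric bilinear form. -/
theorem apply_sq_le_apply_self_mul_apply_self {V : Type*} [AddCommGroup V] [Module ℝ V]
    (a : V →ₗ[ℝ] V →ₗ[ℝ] ℝ) (hsa : ∀ x y, a x y = a y x)
    (hpa : ∀ x, x ≠ 0 → 0 < a x x) (x y : V) :
    a x y ^ 2 ≤ a x x * a y y := by
  refine LinearMap.BilinForm.apply_sq_le_of_symm a (fun z => ?_) ⟨hsa⟩ x y
  rcases eq_or_ne z 0 with rfl | hz
  · simp
  · exact (hpa z hz).le

theorem stmt_18 {V : Type*} [AddCommGroup V] [Module ℝ V] [FiniteDimensional ℝ V]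
    (a b : V →ₗ[ℝ] V →ₗ[ℝ] ℝ)
    (hsa : ∀ x y, a x y = a y x) (hsb : ∀ x y, b x y = b y x)
    (hpa : ∀ x, x ≠ 0 → 0 < a x x) (hpb : ∀ x, x ≠ 0 → 0 < b x x)
    (W : Submodule ℝ V)
    (P : V →ₗ[ℝ] V) (hPmem : ∀ w, P w ∈ W)
    (hPorth : ∀ w, ∀ y ∈ W, a (w - P w) y = 0)
    (T : V →ₗ[ℝ] V) (hT : ∀ f v, a (T f) v = b f v)
    (η : ℝ)
    (hη : η = sSup {r : ℝ | ∃ f : V, b f f = 1 ∧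
        r = sInf {s : ℝ | ∃ w ∈ W, s = Real.sqrt (a (T f - w) (T f - w))}}) :
    ∀ u : V, Real.sqrt (b (u - P u) (u - P u))
      ≤ η * Real.sqrt (a (u - P u) (u - P u)) := by
  intro u
  have horth := hPorth u
  generalize u - P u = e at horth ⊢
  rcases eq_or_ne e 0 with rfl | he
  · simp
  have hbe := hpb e he
  have hβ : 0 < √(b e e) := Real.sqrt_pos.2 hbe
  have hα : 0 < √(a e e) := Real.sqrt_pos.2 (hpa e he)
  obtain ⟨C, hC⟩ := exists_apply_self_le_mul_apply_self a b hsa hpa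
  have hbdd : BddAbove {r : ℝ | ∃ f : V, b f f = 1 ∧
      r = sInf {s : ℝ | ∃ w ∈ W, s = √(a (T f - w) (T f - w))}} := by
    refine ⟨√C, ?_⟩
    rintro _ ⟨f, hf, rfl⟩
    have hle : sInf {s : ℝ | ∃ w ∈ W, s = √(a (T f - w) (T f - w))} ≤ √(a (T f) (T f)) := by
      refine csInf_le ⟨0, ?_⟩ ⟨0, W.zero_mem, by simp⟩
      rintro _ ⟨w, -, rfl⟩
      exact Real.sqrt_nonneg _
    refine hle.trans ?_
    rcases eq_or_ne (T f) 0 with h0 | h0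
    · simp [h0]
    have hcs := apply_sq_le_apply_self_mul_apply_self b hsb hpb f (T f)
    rw [hf, one_mul, ← hT, sq] at hcs
    exact Real.sqrt_le_sqrt (le_of_mul_le_mul_right (hcs.trans (hC _)) (hpa _ h0))
  set f := (√(b e e))⁻¹ • e with hf
  have hff : b f f = 1 := by
    simp only [hf, map_smul, LinearMap.smul_apply, smul_eq_mul]
    rw [← mul_assoc, ← mul_inv, Real.mul_self_sqrt hbe.le, inv_mul_cancel₀ hbe.ne']
  have hfe : b f e = √(b e e) := by
    simp only [hf, map_smul, LinearMap.smul_apply, smul_eq_mul]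
    rw [inv_mul_eq_div, Real.div_sqrt]
  rw [← div_le_iff₀ hα, hη]
  refine le_trans ?_ (le_csSup hbdd ⟨f, hff, rfl⟩)
  refine le_csInf ⟨_, 0, W.zero_mem, rfl⟩ ?_
  rintro _ ⟨w, hw, rfl⟩
  have hinner : a (T f - w) e = √(b e e) := by
    rw [map_sub, LinearMap.sub_apply, hT, hfe, hsa w e, horth w hw, sub_zero]
  rw [div_le_iff₀ hα, ← Real.sqrt_mul' _ (hpa e he).le, ← hinner]
  exact Real.le_sqrt_of_sq_le (apply_sq_le_apply_self_mul_apply_self a hsa hpa _ _)
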